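/- arXiv:2004.01450 — 2 statements merged into one kernel-verified Lean document; each statement's English description precedes it below -/
import Mathlib

section
/- For a sub-Möbius structure M on a set X the following are equivalent: (i) M is a Möbius structure; (ii) δM(reg 𝒫_5) ⊆ R_λ for some edge λ ∈ Λ; (iii) δM(reg 𝒫_5) ⊆ R̂ = ⋂_{λ∈Λ} R_λ. -/
open Equiv

/-- XOR on `Fin 4` (the Klein group structure on vertices of a tetrahedron). -/
def xor4 (a b : Fin 4) : Fin 4 :=
  ⟨(a.val ^^^ b.val) % 4, Nat.mod_lt _ (by norm_num)⟩

/-- The underlying function of the cross-ratio homomorphism `φ : S₄ → S₃`: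
a permutation of the vertices `{0,1,2,3}` of a tetrahedron induces a permutation of the
three partitions of the vertex set into two pairs of opposite edges; the partition pairing
`0` with `j+1` is indexed by `j : Fin 3`. -/
def phiFun (π : Perm (Fin 4)) (j : Fin 3) : Fin 3 :=
  ⟨(xor4 (π 0) (π ⟨j.val + 1, by omega⟩)).val - 1, by
    have h := (xor4 (π 0) (π ⟨j.val + 1, by omega⟩)).isLt
    omega⟩

lemma phiFun_leftInv : ∀ (π : Perm (Fin 4)) (j : Fin 3), phiFun π⁻¹ (phiFun π j) = j := by
  decide

/-- The cross-ratio homomorphism `φ : S₄ → S₃`. -/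
def phi (π : Perm (Fin 4)) : Perm (Fin 3) where
  toFun := phiFun π
  invFun := phiFun π⁻¹
  left_inv := phiFun_leftInv π
  right_inv := fun j => by simpa using phiFun_leftInv π⁻¹ j

/-- Restriction of a permutation `π` to a bijection between the complement of `{i}`
and the complement of `{π i}`. -/
def restrictPerm {k : ℕ} (π : Perm (Fin k)) (i : Fin k) :
    {x : Fin k // x ≠ i} ≃ {x : Fin k // x ≠ π i} where
  toFun x := ⟨π x.1, fun h => x.2 (π.injective h)⟩
  invFun y := ⟨π.symm y.1, fun h => y.2 (by simpa using congrArg π h)⟩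
  left_inv x := Subtype.ext (π.symm_apply_apply x.1)
  right_inv y := Subtype.ext (π.apply_symm_apply y.1)

/-- The induced permutation `π_i ∈ S_k` of `π ∈ S_{k+1}`: the restriction of `π` to the
complement of `{i}`, reindexed via the order preserving identifications with `Fin k`. -/
def inducedPerm {k : ℕ} (π : Perm (Fin (k + 1))) (i : Fin (k + 1)) : Perm (Fin k) :=
  ((finSuccAboveEquiv i).trans ((restrictPerm π i).trans (finSuccAboveEquiv (π i)).symm))

open scoped ENNReal

/-- A semi-metric on `X`: a symmetric function `d : X² → [0,∞]` vanishing exactly on the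
diagonal, having at most one infinitely remote point `ω` (distances to `ω` from points
`≠ ω` are `∞`, and all other distances are finite). -/
structure SemiMetric (X : Type*) where
  d : X → X → ℝ≥0∞
  symm : ∀ x y, d x y = d y x
  eq_zero_iff : ∀ x y, d x y = 0 ↔ x = y
  remote : ∃ S : Set X, S.Subsingleton ∧ ∀ x y, x ≠ y → (d x y = ⊤ ↔ x ∈ S ∨ y ∈ S)

/-- The "Gromov product" `(x|y) = −ln d(x,y) ∈ [−∞,∞]`. -/
noncomputable def ip {X : Type*} (m : SemiMetric X) (x y : X) : EReal :=
  - (m.d x y).log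

open Classical in
/-- Difference `u - v` in `[−∞,∞]` with the agreement that two equal infinities cancel:
`(∞) − (∞) = 0 = (−∞) − (−∞)`. -/
noncomputable def cd2 (u v : EReal) : EReal :=
  if (u = ⊤ ∨ u = ⊥) ∧ u = v then 0 else u - v

open Classical in
/-- The combination `(p + q) − (r + s)` in `[−∞,∞]`, computed with the agreement of the
paper (`(a+∞) − (b+∞) = 0`): an infinite term on the positive side cancels against an
equal infinite term on the negative side. -/
noncomputable def cd4 (p q r s : EReal) : EReal :=
  if (p = ⊤ ∨ p = ⊥) ∧ p = r then cd2 q s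
  else if (p = ⊤ ∨ p = ⊥) ∧ p = s then cd2 q r
  else if (q = ⊤ ∨ q = ⊥) ∧ q = r then cd2 p s
  else if (q = ⊤ ∨ q = ⊥) ∧ q = s then cd2 p r
  else (p + q) - (r + s)

/-- The Möbius structure `M_d` associated with a semi-metric `d`:
`M_d(x₁,x₂,x₃,x₄) = (a,b,c)` with
`a = (x₁|x₄)+(x₂|x₃)−(x₁|x₃)−(x₂|x₄)`,
`b = (x₁|x₂)+(x₃|x₄)−(x₁|x₄)−(x₂|x₃)`,
`c = (x₂|x₄)+(x₁|x₃)−(x₁|x₂)−(x₃|x₄)`. -/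
noncomputable def Md {X : Type*} (m : SemiMetric X) (Q : Fin 4 → X) : Fin 3 → EReal :=
  ![cd4 (ip m (Q 0) (Q 3)) (ip m (Q 1) (Q 2)) (ip m (Q 0) (Q 2)) (ip m (Q 1) (Q 3)),
    cd4 (ip m (Q 0) (Q 1)) (ip m (Q 2) (Q 3)) (ip m (Q 0) (Q 3)) (ip m (Q 1) (Q 2)),
    cd4 (ip m (Q 1) (Q 3)) (ip m (Q 0) (Q 2)) (ip m (Q 0) (Q 1)) (ip m (Q 2) (Q 3))]

/-- A 4-tuple is admissible if it contains at most two equal entries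
(no value occurs three or more times). -/
def Admissible4 {X : Type*} (Q : Fin 4 → X) : Prop :=
  ∀ i j k : Fin 4, i ≠ j → i ≠ k → j ≠ k → ¬(Q i = Q j ∧ Q i = Q k)

/-- The plane `L₄ ⊂ ℝ³` of triples with `a + b + c = 0`, viewed inside `[−∞,∞]³`. -/
def L4set : Set (Fin 3 → EReal) :=
  {p | ∃ u : Fin 3 → ℝ, u 0 + u 1 + u 2 = 0 ∧ p = fun j => (u j : EReal)}

/-- The extension `L̄₄ = L₄ ∪ {A, B, C}` by the three infinitely remote points
`A = (0,∞,−∞)`, `B = (−∞,0,∞)`, `C = (∞,−∞,0)`. -/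
def Lbar4 : Set (Fin 3 → EReal) :=
  L4set ∪ {![0, ⊤, ⊥], ![⊥, 0, ⊤], ![⊤, ⊥, 0]}

open Classical in
/-- The signed action of `σ ∈ S₃` (with sign `ε`) on `[−∞,∞]³`: coordinates are permuted
by `σ` and multiplied by `−1` when `ε = −1`. -/
noncomputable def signedAct3 (ε : ℤˣ) (σ : Equiv.Perm (Fin 3)) (p : Fin 3 → EReal) :
    Fin 3 → EReal :=
  fun j => if ε = 1 then p (σ⁻¹ j) else - p (σ⁻¹ j)

/-- A sub-Möbius structure on `X`: a map `M` on admissible 4-tuples with values in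
`L̄₄ ⊂ [−∞,∞]³` such that (a) `M(πQ) = sign(π) φ(π) M(Q)` for the signed cross-ratio
homomorphism; (b) `M(Q) ∈ L₄` iff `Q` is nondegenerate; (c) `M(x₁,x₁,x₃,x₄) = (0,∞,−∞)`.
(The map is defined on all 4-tuples; only its values on admissible tuples are constrained.) -/
structure SubMoebius (X : Type*) where
  M : (Fin 4 → X) → Fin 3 → EReal
  mem_Lbar : ∀ Q, Admissible4 Q → M Q ∈ Lbar4
  equivariant : ∀ Q, Admissible4 Q → ∀ π : Equiv.Perm (Fin 4),
    M (fun k => Q (π⁻¹ k)) = signedAct3 (Equiv.Perm.sign π) (phi π) (M Q)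
  mem_L4_iff : ∀ Q, Admissible4 Q → (M Q ∈ L4set ↔ Function.Injective Q)
  diag : ∀ x z w : X, Admissible4 ![x, x, z, w] → M ![x, x, z, w] = ![0, ⊤, ⊥]

/-- A sub-Möbius structure is a Möbius structure if it is generated by a semi-metric. -/
def IsMoebius {X : Type*} (S : SubMoebius X) : Prop :=
  ∃ m : SemiMetric X, ∀ Q, Admissible4 Q → S.M Q = Md m Q

/-- `del P i = P_i`, the 4-tuple obtained from the 5-tuple `P` by deleting the
`i`-th entry. -/
def del {X : Type*} (P : Fin 5 → X) (i : Fin 5) : Fin 4 → X :=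
  fun k => P (i.succAbove k)

/-- A 5-tuple is admissible if all its 4-subtuples are admissible. -/
def Admissible5 {X : Type*} (P : Fin 5 → X) : Prop :=
  ∀ i, Admissible4 (del P i)

/-- The codifferential `δM` of a sub-Möbius structure: `δM(P)_i = M(P_i)`. -/
noncomputable def deltaM {X : Type*} (S : SubMoebius X) (P : Fin 5 → X) :
    Fin 5 → Fin 3 → EReal :=
  fun i => S.M (del P i)

/-- The canonical representation `η₅` acting on `5 × 3` matrices with entries in
`[−∞,∞]` (the space `L̄₅`): `η₅(π)(e_i ⊗ u) = e_{π(i)} ⊗ η₄(π_i)(u)`, where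
`η₄(σ) = sign(σ) φ(σ)` acts by signed coordinate permutations. -/
noncomputable def eta5E (π : Equiv.Perm (Fin 5)) (w : Fin 5 → Fin 3 → EReal) :
    Fin 5 → Fin 3 → EReal :=
  fun i =>
    signedAct3 (Equiv.Perm.sign (inducedPerm π (π⁻¹ i))) (phi (inducedPerm π (π⁻¹ i)))
      (w (π⁻¹ i))

/-- The subset `L₅ = W⁵ ⊗ L₄` of matrices all of whose rows lie in `L₄`. -/
def L5E : Set (Fin 5 → Fin 3 → EReal) := {w | ∀ i, w i ∈ L4set}

/-- Coefficient matrices of the ten characteristic functionals `r_λ`, `λ` an edge of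
`{1,…,5}` (0-indexed: rows `1,…,5` become `0,…,4`, columns `(a,b,c)` become `(0,1,2)`).
`rc p q` is the coefficient matrix of `r_{(p+1)(q+1)}` for `p < q`, and `0` otherwise. -/
def rc : Fin 5 → Fin 5 → Fin 5 → Fin 3 → ℝ :=
  -- r₁₂ = −a₃+a₄−a₅, r₁₃ = −a₂−b₄+b₅, r₁₄ = b₂−b₃−c₅, r₁₅ = −c₂+c₃−c₄,
  -- r₂₃ = −a₁+c₄−c₅, r₂₄ = b₁+c₃+b₅, r₂₅ = −c₁−b₃+b₄,
  -- r₃₄ = −c₁+c₂−a₅, r₃₅ = b₁−b₂−a₄, r₄₅ = −a₁+a₂−a₃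
  ![![0,
     ![![0,0,0], ![0,0,0], ![-1,0,0], ![1,0,0], ![-1,0,0]],
     ![![0,0,0], ![-1,0,0], ![0,0,0], ![0,-1,0], ![0,1,0]],
     ![![0,0,0], ![0,1,0], ![0,-1,0], ![0,0,0], ![0,0,-1]],
     ![![0,0,0], ![0,0,-1], ![0,0,1], ![0,0,-1], ![0,0,0]]],
    ![0, 0,
     ![![-1,0,0], ![0,0,0], ![0,0,0], ![0,0,1], ![0,0,-1]],
     ![![0,1,0], ![0,0,0], ![0,0,1], ![0,0,0], ![0,1,0]],
     ![![0,0,-1], ![0,0,0], ![0,-1,0], ![0,1,0], ![0,0,0]]],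
    ![0, 0, 0,
     ![![0,0,-1], ![0,0,1], ![0,0,0], ![0,0,0], ![-1,0,0]],
     ![![0,1,0], ![0,-1,0], ![0,0,0], ![-1,0,0], ![0,0,0]]],
    ![0, 0, 0, 0,
     ![![-1,0,0], ![1,0,0], ![-1,0,0], ![0,0,0], ![0,0,0]]],
    ![0, 0, 0, 0, 0]]

/-- The characteristic functional `r_λ : V⁵ → ℝ` for the edge `λ = {p,q}`, `p < q`. -/
def rfun (p q : Fin 5) (v : Fin 5 → Fin 3 → ℝ) : ℝ :=
  ∑ i, ∑ j, rc p q i j * v i j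

/-- The characteristic functional `r_λ`, `λ = {p,q}` with `p < q`, extended to matrices
with entries in `[−∞,∞]`. -/
noncomputable def rfunE (p q : Fin 5) (w : Fin 5 → Fin 3 → EReal) : EReal :=
  ∑ i, ∑ j, ((rc p q i j : ℝ) : EReal) * w i j

/-- The root set `R_λ = {v ∈ L₅ : r_λ(v) = 0}`. -/
def RrootE (p q : Fin 5) : Set (Fin 5 → Fin 3 → EReal) :=
  {w ∈ L5E | rfunE p q w = 0}

/-- The symmetry set `R̂ = ⋂_{λ ∈ Λ} R_λ`. -/
def RhatE : Set (Fin 5 → Fin 3 → EReal) :=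
  {w ∈ L5E | ∀ p q : Fin 5, p < q → rfunE p q w = 0}

section Helpers

/-- Quadrilinear-type cocycle reconstruction of a symmetric function. -/
lemma exists_potential {X : Type*} (F : X → X → X → X → ℝ)
    (h1 : ∀ x y z w, [x, y, z, w].Nodup → F y x z w = - F x y z w)
    (h2 : ∀ x y z w, [x, y, z, w].Nodup → F z w x y = F x y z w)
    (h3 : ∀ x y z w, [x, y, z, w].Nodup → F x y z w + F x z w y + F x w y z = 0)
    (h4 : ∀ x y z w v, [x, y, z, w, v].Nodup → F x y z v = F x y z w + F x y w v) :
    ∃ g : X → X → ℝ, (∀ x y, g x y = g y x) ∧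
      ∀ x y z w, [x, y, z, w].Nodup → F x y z w = g x w + g y z - g x z - g y w := by
  classical
  by_cases hX : ∃ o e ω : X, o ≠ e ∧ o ≠ ω ∧ e ≠ ω
  swap
  · refine ⟨fun _ _ => 0, fun _ _ => rfl, fun x y z w h => ?_⟩
    exact absurd ⟨x, y, z, by simp at h; tauto, by simp at h; tauto, by simp at h; tauto⟩ hX
  obtain ⟨o, e, ω, hoe, how, hew⟩ := hX
  obtain ⟨f, hf, hf0⟩ : ∃ f : X → X → X → X → ℝ,
      (∀ x y z w, [x, y, z, w].Nodup → f x y z w = F x y z w) ∧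
      (∀ x y z w, ¬ [x, y, z, w].Nodup → f x y z w = 0) :=
    ⟨fun x y z w => if [x, y, z, w].Nodup then F x y z w else 0,
      fun x y z w h => if_pos h, fun x y z w h => if_neg h⟩
  have s1 : ∀ x y z w, f y x z w = - f x y z w := by
    intro x y z w
    by_cases h : [x, y, z, w].Nodup
    · have h' : [y, x, z, w].Nodup := by simp at h ⊢; grind
      rw [hf _ _ _ _ h, hf _ _ _ _ h', h1 _ _ _ _ h]
    · have h' : ¬ [y, x, z, w].Nodup := by simp at h ⊢; grind
      rw [hf0 _ _ _ _ h, hf0 _ _ _ _ h']; simp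
  have s2 : ∀ x y z w, f z w x y = f x y z w := by
    intro x y z w
    by_cases h : [x, y, z, w].Nodup
    · have h' : [z, w, x, y].Nodup := by simp at h ⊢; grind
      rw [hf _ _ _ _ h, hf _ _ _ _ h', h2 _ _ _ _ h]
    · have h' : ¬ [z, w, x, y].Nodup := by simp at h ⊢; grind
      rw [hf0 _ _ _ _ h, hf0 _ _ _ _ h']
  have s2' : ∀ x y z w, f x y w z = - f x y z w := by
    intro x y z w
    rw [← s2, s1, s2]
  have s3 : ∀ x y z w, f x y z w + f x z w y + f x w y z = 0 := by
    intro x y z w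
    by_cases h : [x, y, z, w].Nodup
    · have h' : [x, z, w, y].Nodup := by simp at h ⊢; grind
      have h'' : [x, w, y, z].Nodup := by simp at h ⊢; grind
      rw [hf _ _ _ _ h, hf _ _ _ _ h', hf _ _ _ _ h'', h3 _ _ _ _ h]
    · have h' : ¬ [x, z, w, y].Nodup := by simp at h ⊢; grind
      have h'' : ¬ [x, w, y, z].Nodup := by simp at h ⊢; grind
      rw [hf0 _ _ _ _ h, hf0 _ _ _ _ h', hf0 _ _ _ _ h'']; simp
  have z34 : ∀ x y z, f x y z z = 0 := fun x y z => hf0 _ _ _ _ (by simp)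
  have z12 : ∀ x z w, f x x z w = 0 := fun x y z => hf0 _ _ _ _ (by simp)
  have s4 : ∀ x y z w v, x ≠ z → x ≠ w → x ≠ v → y ≠ z → y ≠ w → y ≠ v →
      f x y z v = f x y z w + f x y w v := by
    intro x y z w v a1 a2 a3 a4 a5 a6
    by_cases e1 : x = y
    · subst e1; simp [z12]
    by_cases e2 : z = w
    · subst e2; simp [z34]
    by_cases e3 : w = v
    · subst e3; simp [z34]
    by_cases e4 : z = v
    · subst e4; rw [s2' x y z w]; simp [z34]
    rw [hf _ _ _ _ (by simp; grind), hf _ _ _ _ (by simp; grind), hf _ _ _ _ (by simp; grind)]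
    exact h4 _ _ _ _ _ (by simp; grind)
  have s5 : ∀ x y z w v, x ≠ z → x ≠ w → x ≠ v → y ≠ z → y ≠ w → y ≠ v →
      f z v x y = f z w x y + f w v x y := by
    intro x y z w v a1 a2 a3 a4 a5 a6
    rw [s2, s2 x y z w, s2 x y w v]
    exact s4 _ _ _ _ _ a1 a2 a3 a4 a5 a6
  -- the potential
  obtain ⟨g, g1, g2, g3, g4, g5⟩ : ∃ g : X → X → ℝ, (∀ x, g x ω = 0) ∧ (∀ x, g ω x = 0) ∧
      (∀ y, y ≠ ω → g o y = f e y o ω) ∧ (∀ y, y ≠ ω → y ≠ o → g y o = f e y o ω) ∧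
      (∀ x y, x ≠ ω → y ≠ ω → x ≠ o → y ≠ o → g x y = f e y o ω + f o x y ω) := by
    refine ⟨fun x y => if x = ω ∨ y = ω then 0 else if x = o then f e y o ω
      else if y = o then f e x o ω else f e y o ω + f o x y ω, ?_, ?_, ?_, ?_, ?_⟩
    · intro x; simp
    · intro x; simp
    · intro y hy; simp [hy, how]
    · intro y hy hy'; simp [hy, how, hy']
    · intro x y a b c d; simp [a, b, c, d]
  have hd : ∀ x y, x ≠ o → y ≠ o → x ≠ ω → y ≠ ω → f e y o ω - f e x o ω = f x y o ω := by
    intro x y a b c d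
    have := s5 o ω e x y hoe (Ne.symm a) (Ne.symm b) hew.symm (Ne.symm c) (Ne.symm d)
    linarith
  have gs : ∀ x y, g x y = g y x := by
    intro x y
    by_cases a : x = ω
    · subst a; rw [g1, g2]
    by_cases b : y = ω
    · subst b; rw [g1, g2]
    by_cases c : x = o
    · subst c
      by_cases d : y = x
      · subst d; rfl
      rw [g3 _ b, g4 _ b d]
    by_cases d : y = o
    · subst d
      rw [g3 _ a, g4 _ a c]
    rw [g5 _ _ a b c d, g5 _ _ b a d c]
    have e1 := hd x y c d a b
    have e2 := s3 o x y ω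
    have e3 := s2 x y o ω
    have e4 := s2' o ω x y
    have e5 := s2' o y x ω
    linarith
  have st : ∀ x y z, x ≠ y → x ≠ z → y ≠ z → x ≠ ω → y ≠ ω → z ≠ ω →
      f x y z ω = g y z - g x z := by
    intro x y z a1 a2 a3 a4 a5 a6
    by_cases c : z = o
    · subst c
      rw [g4 _ a5 a3, g4 _ a4 a2]
      exact (hd x y a2 a3 a4 a5).symm
    have key : ∀ x, x ≠ ω → g x z = f e z o ω + f o x z ω := by
      intro x hx
      by_cases d : x = o
      · subst d; rw [g3 _ a6, z12]; simp
      · exact g5 _ _ hx a6 d c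
    rw [key _ a4, key _ a5]
    have := s5 z ω o x y (by tauto) (Ne.symm a2) (Ne.symm a3) how.symm (Ne.symm a4) (Ne.symm a5)
    linarith
  have st2 : ∀ x y z w, [x, y, z, w].Nodup → x ≠ ω → y ≠ ω →
      f x y z w = g x w + g y z - g x z - g y w := by
    intro x y z w h hx hy
    simp only [List.nodup_cons, List.mem_cons, List.not_mem_nil, not_or] at h
    obtain ⟨⟨a1, a2, a3, -⟩, ⟨a4, a5, -⟩, ⟨a6, -⟩, -⟩ := h
    by_cases c : w = ω
    · subst c
      rw [st _ _ _ a1 a2 a4 hx hy a6, g1, g1]; ring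
    by_cases d : z = ω
    · subst d
      rw [s2' x y w z, st _ _ _ a1 a3 a5 hx hy c, g1, g1]; ring
    have e1 := s4 x y z ω w a2 hx a3 a4 hy a5
    have e2 := s2' x y w ω
    rw [st _ _ _ a1 a2 a4 hx hy d] at e1
    rw [st _ _ _ a1 a3 a5 hx hy c] at e2
    linarith
  refine ⟨g, gs, fun x y z w h => ?_⟩
  rw [← hf _ _ _ _ h]
  by_cases c : x = ω ∨ y = ω
  · have h' : [z, w, x, y].Nodup := by simp at h ⊢; grind
    have := st2 z w x y h' (by simp at h; grind) (by simp at h; grind)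
    rw [← s2, this, gs z y, gs w x, gs z x, gs w y]; ring
  · push Not at c
    exact st2 x y z w h c.1 c.2

lemma admissible_of_injective {X : Type*} {Q : Fin 4 → X} (h : Function.Injective Q) :
    Admissible4 Q := fun _ _ _ hij _ _ hh => hij (h hh.1)

lemma inj_vec4 {X : Type*} {x y z w : X} (h : [x, y, z, w].Nodup) :
    Function.Injective ![x, y, z, w] := by
  rw [← List.nodup_ofFn]; simpa [List.ofFn_succ] using h

lemma inj_vec5 {X : Type*} {x y z w v : X} (h : [x, y, z, w, v].Nodup) :
    Function.Injective ![x, y, z, w, v] := by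
  rw [← List.nodup_ofFn]; simpa [List.ofFn_succ] using h

/-- The first coordinate as a real number. -/
noncomputable def fstCoord {X : Type*} (S : SubMoebius X) (x y z w : X) : ℝ :=
  (S.M ![x, y, z, w] 0).toReal

lemma vec4_perm {X : Type*} (x y z w : X) (π : Equiv.Perm (Fin 4)) :
    (fun k => ![x, y, z, w] (π k)) =
      ![![x, y, z, w] (π 0), ![x, y, z, w] (π 1), ![x, y, z, w] (π 2), ![x, y, z, w] (π 3)] := by
  ext k; fin_cases k <;> rfl

/-- The 3-cycle used to rotate coordinates. -/
def rot : Equiv.Perm (Fin 4) := Equiv.swap 1 2 * Equiv.swap 1 3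

lemma M_rot {X : Type*} (S : SubMoebius X) (x y z w : X) (h : [x, y, z, w].Nodup) :
    S.M ![x, z, w, y] 0 = S.M ![x, y, z, w] 1 ∧ S.M ![x, z, w, y] 1 = S.M ![x, y, z, w] 2 := by
  have e := S.equivariant _ (admissible_of_injective (inj_vec4 h)) rot
  rw [vec4_perm] at e
  have q0 : rot⁻¹ 0 = 0 := by decide
  have q1 : rot⁻¹ 1 = 2 := by decide
  have q2 : rot⁻¹ 2 = 3 := by decide
  have q3 : rot⁻¹ 3 = 1 := by decide
  have sg : Equiv.Perm.sign rot = 1 := by decide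
  have p0 : (phi rot)⁻¹ 0 = 1 := by decide
  have p1 : (phi rot)⁻¹ 1 = 2 := by decide
  rw [q0, q1, q2, q3] at e
  constructor
  · have := congrFun e 0
    simpa [signedAct3, sg, p0] using this
  · have := congrFun e 1
    simpa [signedAct3, sg, p1] using this

lemma M_eq {X : Type*} (S : SubMoebius X) (x y z w : X) (h : [x, y, z, w].Nodup) :
    S.M ![x, y, z, w] = (fun j => ((![fstCoord S x y z w, fstCoord S x z w y,
      fstCoord S x w y z] j : ℝ) : EReal)) ∧
    fstCoord S x y z w + fstCoord S x z w y + fstCoord S x w y z = 0 := by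
  obtain ⟨u, hu, e⟩ := (S.mem_L4_iff _ (admissible_of_injective (inj_vec4 h))).2 (inj_vec4 h)
  have h' : [x, z, w, y].Nodup := by simp at h ⊢; grind
  have r1 := M_rot S x y z w h
  have r2 := M_rot S x z w y h'
  have a0 : fstCoord S x y z w = u 0 := by simp [fstCoord, e]
  have a1 : fstCoord S x z w y = u 1 := by simp [fstCoord, r1.1, e]
  have a2 : fstCoord S x w y z = u 2 := by simp [fstCoord, r2.1, r1.2, e]
  rw [a0, a1, a2]
  refine ⟨?_, hu⟩
  rw [e]; ext j; fin_cases j <;> rfl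

lemma F_swap {X : Type*} (S : SubMoebius X) (x y z w : X) (h : [x, y, z, w].Nodup) :
    fstCoord S y x z w = - fstCoord S x y z w := by
  have e := S.equivariant _ (admissible_of_injective (inj_vec4 h)) (Equiv.swap 0 1)
  rw [vec4_perm] at e
  have q0 : (Equiv.swap (0 : Fin 4) 1)⁻¹ 0 = 1 := by decide
  have q1 : (Equiv.swap (0 : Fin 4) 1)⁻¹ 1 = 0 := by decide
  have q2 : (Equiv.swap (0 : Fin 4) 1)⁻¹ 2 = 2 := by decide
  have q3 : (Equiv.swap (0 : Fin 4) 1)⁻¹ 3 = 3 := by decide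
  have sg : Equiv.Perm.sign (Equiv.swap (0 : Fin 4) 1) = -1 := by decide
  have p0 : (phi (Equiv.swap (0 : Fin 4) 1))⁻¹ 0 = 0 := by decide
  rw [q0, q1, q2, q3] at e
  have h0 := congrFun e 0
  simp only [signedAct3, sg, p0] at h0
  rw [if_neg (by decide)] at h0
  change S.M ![y, x, z, w] 0 = _ at h0
  rw [fstCoord, h0, EReal.toReal_neg_eq]
  rfl

/-- The double transposition exchanging the two pairs. -/
def dbl : Equiv.Perm (Fin 4) := Equiv.swap 0 2 * Equiv.swap 1 3

lemma F_dbl {X : Type*} (S : SubMoebius X) (x y z w : X) (h : [x, y, z, w].Nodup) :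
    fstCoord S z w x y = fstCoord S x y z w := by
  have e := S.equivariant _ (admissible_of_injective (inj_vec4 h)) dbl
  rw [vec4_perm] at e
  have q0 : dbl⁻¹ 0 = 2 := by decide
  have q1 : dbl⁻¹ 1 = 3 := by decide
  have q2 : dbl⁻¹ 2 = 0 := by decide
  have q3 : dbl⁻¹ 3 = 1 := by decide
  have sg : Equiv.Perm.sign dbl = 1 := by decide
  have p0 : (phi dbl)⁻¹ 0 = 0 := by decide
  rw [q0, q1, q2, q3] at e
  have h0 := congrFun e 0
  simp only [signedAct3, sg, p0, if_true] at h0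
  change S.M ![z, w, x, y] 0 = _ at h0
  rw [fstCoord, h0]
  rfl

/-- Real matrix of the codifferential in terms of `fstCoord`-like function `F`. -/
def codiffReal {X : Type*} (F : X → X → X → X → ℝ) (P : Fin 5 → X) : Fin 5 → Fin 3 → ℝ :=
  fun i => let Q := del P i
    ![F (Q 0) (Q 1) (Q 2) (Q 3), F (Q 0) (Q 2) (Q 3) (Q 1), F (Q 0) (Q 3) (Q 1) (Q 2)]

lemma rfunE_coe (p q : Fin 5) (v : Fin 5 → Fin 3 → ℝ) :
    rfunE p q (fun i j => (v i j : EReal)) = ((rfun p q v : ℝ) : EReal) := by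
  simp [rfunE, rfun, Fin.sum_univ_succ]

lemma nodup_of_inj4 {X : Type*} {Q : Fin 4 → X} (h : Function.Injective Q) :
    [Q 0, Q 1, Q 2, Q 3].Nodup := by
  rw [← List.nodup_ofFn] at h; simpa [List.ofFn_succ] using h

lemma del_inj {X : Type*} {P : Fin 5 → X} (h : Function.Injective P) (i : Fin 5) :
    Function.Injective (del P i) := h.comp (Fin.succAbove_right_injective)

lemma vec4_eta {X : Type*} (Q : Fin 4 → X) : ![Q 0, Q 1, Q 2, Q 3] = Q := by
  ext k; fin_cases k <;> rfl

lemma deltaM_eq {X : Type*} (S : SubMoebius X) (P : Fin 5 → X) (h : Function.Injective P) :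
    deltaM S P = fun i j => ((codiffReal (fstCoord S) P i j : ℝ) : EReal) := by
  funext i
  have := (M_eq S _ _ _ _ (nodup_of_inj4 (del_inj h i))).1
  rw [vec4_eta] at this
  exact this

lemma F_sym {X : Type*} (S : SubMoebius X) (x y z w : X) (h : [x, y, z, w].Nodup) :
    fstCoord S y x z w = - fstCoord S x y z w ∧ fstCoord S x y w z = - fstCoord S x y z w ∧
    fstCoord S y x w z = fstCoord S x y z w ∧ fstCoord S z w x y = fstCoord S x y z w ∧
    fstCoord S w z x y = - fstCoord S x y z w ∧ fstCoord S z w y x = - fstCoord S x y z w ∧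
    fstCoord S w z y x = fstCoord S x y z w := by
  have n1 : [y, x, z, w].Nodup := by simp at h ⊢; grind
  have n2 : [z, w, x, y].Nodup := by simp at h ⊢; grind
  have n3 : [w, z, x, y].Nodup := by simp at h ⊢; grind
  have n4 : [w, z, y, x].Nodup := by simp at h ⊢; grind
  have a1 := F_swap S _ _ _ _ h
  have a2 := F_dbl S _ _ _ _ h
  have a3 := F_swap S _ _ _ _ n2
  have a4 := F_dbl S _ _ _ _ n3
  have a5 := F_dbl S _ _ _ _ n4
  have a6 := F_dbl S _ _ _ _ n1
  have a7 := F_swap S _ _ _ _ n4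
  refine ⟨?_, ?_, ?_, ?_, ?_, ?_, ?_⟩ <;> linarith

/-- Explicit form of `codiffReal` on a vector. -/
def codiffVec {X : Type*} (F : X → X → X → X → ℝ) (a b c d e : X) : Fin 5 → Fin 3 → ℝ :=
  ![![F b c d e, F b d e c, F b e c d], ![F a c d e, F a d e c, F a e c d],
    ![F a b d e, F a d e b, F a e b d], ![F a b c e, F a c e b, F a e b c],
    ![F a b c d, F a c d b, F a d b c]]

lemma codiffReal_vec {X : Type*} (F : X → X → X → X → ℝ) (a b c d e : X) :
    codiffReal F ![a, b, c, d, e] = codiffVec F a b c d e := by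
  funext i j; fin_cases i <;> fin_cases j <;> rfl

lemma cocycle_of_root {X : Type*} (S : SubMoebius X) (p q : Fin 5) (hpq : p < q)
    (H : ∀ P : Fin 5 → X, Function.Injective P → rfun p q (codiffReal (fstCoord S) P) = 0)
    (x y z w v : X) (h : [x, y, z, w, v].Nodup) :
    fstCoord S x y z v = fstCoord S x y z w + fstCoord S x y w v := by
  have n1 := F_sym S x y z w (by simp at h ⊢; grind)
  have n2 := F_sym S x y z v (by simp at h ⊢; grind)
  have n3 := F_sym S x y w v (by simp at h ⊢; grind)
  have m1 := F_sym S x z w v (by simp at h ⊢; grind)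
  have H' : ∀ a b c d e : X, [a, b, c, d, e].Nodup →
      rfun p q (codiffReal (fstCoord S) ![a, b, c, d, e]) = 0 :=
    fun a b c d e hh => H _ (inj_vec5 hh)
  clear H
  have hP : ∀ a b c d e : X, [a, b, c, d, e].Nodup →
      rfun p q (codiffVec (fstCoord S) a b c d e) = 0 := by
    intro a b c d e hh
    rw [← codiffReal_vec]
    exact H' a b c d e hh
  clear H'
  fin_cases p <;> fin_cases q <;> first | (exact absurd hpq (by decide)) | skip
  · have c := hP x y z w v (by simp at h ⊢; grind)
    simp [rfun, rc, codiffVec, Fin.sum_univ_succ] at c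
    linarith
  · have c := hP x z y w v (by simp at h ⊢; grind)
    simp [rfun, rc, codiffVec, Fin.sum_univ_succ] at c
    linarith
  · have c := hP x z w y v (by simp at h ⊢; grind)
    simp [rfun, rc, codiffVec, Fin.sum_univ_succ] at c
    linarith
  · have c := hP x z w v y (by simp at h ⊢; grind)
    simp [rfun, rc, codiffVec, Fin.sum_univ_succ] at c
    linarith
  · have c := hP z x y w v (by simp at h ⊢; grind)
    simp [rfun, rc, codiffVec, Fin.sum_univ_succ] at c
    linarith
  · have c := hP z x w y v (by simp at h ⊢; grind)
    simp [rfun, rc, codiffVec, Fin.sum_univ_succ] at c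
    linarith
  · have c := hP z x w v y (by simp at h ⊢; grind)
    simp [rfun, rc, codiffVec, Fin.sum_univ_succ] at c
    linarith
  · have c := hP z w x y v (by simp at h ⊢; grind)
    simp [rfun, rc, codiffVec, Fin.sum_univ_succ] at c
    linarith
  · have c := hP z w x v y (by simp at h ⊢; grind)
    simp [rfun, rc, codiffVec, Fin.sum_univ_succ] at c
    linarith
  · have c := hP z w v x y (by simp at h ⊢; grind)
    simp [rfun, rc, codiffVec, Fin.sum_univ_succ] at c
    linarith


lemma cd4_real (p q r s : ℝ) : cd4 p q r s = ((p + q - r - s : ℝ) : EReal) := by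
  simp only [cd4, EReal.coe_ne_top, EReal.coe_ne_bot, or_self, false_and, if_false]
  norm_cast
  ring

lemma cd2_real (p q : ℝ) : cd2 p q = ((p - q : ℝ) : EReal) := by
  simp [cd2]

lemma cd4_pr (q s : ℝ) : cd4 ⊥ q ⊥ s = ((q - s : ℝ) : EReal) := by
  simp [cd4, cd2_real]

lemma cd4_ps (q r : ℝ) : cd4 ⊥ q r ⊥ = ((q - r : ℝ) : EReal) := by
  simp [cd4, cd2_real]

lemma cd4_qr (p s : ℝ) : cd4 p ⊥ ⊥ s = ((p - s : ℝ) : EReal) := by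
  simp [cd4, cd2_real]

lemma cd4_qs (p r : ℝ) : cd4 p ⊥ r ⊥ = ((p - r : ℝ) : EReal) := by
  simp [cd4, cd2_real]

lemma Md_real {X : Type*} (m : SemiMetric X) : ∃ g : X → X → ℝ,
    (∀ x y, g x y = g y x) ∧ ∀ x y z w, [x, y, z, w].Nodup → (Md m ![x, y, z, w] 0).toReal = g x w + g y z - g x z - g y w := by
  classical
  obtain ⟨T, hT, hd⟩ := m.remote
  refine ⟨fun x y => if x ∈ T ∨ y ∈ T then 0 else (ip m x y).toReal, fun x y => ?_, fun x y z w h => ?_⟩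
  · simp only [ip, m.symm x y, or_comm]
  have k1 : ∀ x y, x ≠ y → (x ∈ T ∨ y ∈ T) → ip m x y = ⊥ := by
    intro x y hxy hh
    rw [ip, (hd x y hxy).2 hh]; simp
  have k2 : ∀ x y, x ≠ y → x ∉ T → y ∉ T → ip m x y = (((ip m x y).toReal : ℝ) : EReal) := by
    intro x y hxy hx hy
    have h1 : m.d x y ≠ ⊤ := fun e => by have := (hd x y hxy).1 e; tauto
    have h2 : m.d x y ≠ 0 := fun e => hxy ((m.eq_zero_iff x y).1 e)
    rw [EReal.coe_toReal]
    · simp [ip, h2]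
    · simp [ip, h1]
  simp only [List.nodup_cons, List.mem_cons, List.not_mem_nil, not_or] at h
  obtain ⟨⟨a1, a2, a3, -⟩, ⟨a4, a5, -⟩, ⟨a6, -⟩, -⟩ := h
  change (cd4 (ip m x w) (ip m y z) (ip m x z) (ip m y w)).toReal = _
  by_cases hx : x ∈ T
  · have hy : y ∉ T := fun hh => a1 (hT hx hh)
    have hz : z ∉ T := fun hh => a2 (hT hx hh)
    have hw : w ∉ T := fun hh => a3 (hT hx hh)
    rw [k1 x w a3 (Or.inl hx), k1 x z a2 (Or.inl hx), k2 y z a4 hy hz, k2 y w a5 hy hw, cd4_pr, EReal.toReal_coe]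
    simp [hx, hy, hz, hw]
  by_cases hy : y ∈ T
  · have hz : z ∉ T := fun hh => a4 (hT hy hh)
    have hw : w ∉ T := fun hh => a5 (hT hy hh)
    rw [k1 y z a4 (Or.inl hy), k1 y w a5 (Or.inl hy), k2 x w a3 hx hw, k2 x z a2 hx hz, cd4_qs, EReal.toReal_coe]
    simp [hx, hy, hz, hw]
  by_cases hz : z ∈ T
  · have hw : w ∉ T := fun hh => a6 (hT hz hh)
    rw [k1 y z a4 (Or.inr hz), k1 x z a2 (Or.inr hz), k2 x w a3 hx hw, k2 y w a5 hy hw, cd4_qr, EReal.toReal_coe]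
    simp [hx, hy, hz, hw]
  by_cases hw : w ∈ T
  · rw [k1 x w a3 (Or.inr hw), k1 y w a5 (Or.inr hw), k2 y z a4 hy hz, k2 x z a2 hx hz, cd4_ps, EReal.toReal_coe]
    simp [hx, hy, hz, hw]
  rw [k2 x w a3 hx hw, k2 y w a5 hy hw, k2 y z a4 hy hz, k2 x z a2 hx hz, cd4_real, EReal.toReal_coe]
  simp [hx, hy, hz, hw]

lemma vec5_eta {X : Type*} (P : Fin 5 → X) : ![P 0, P 1, P 2, P 3, P 4] = P := by
  ext k; fin_cases k <;> rfl

lemma rhat_of_moebius {X : Type*} (S : SubMoebius X) (hS : IsMoebius S) (P : Fin 5 → X)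
    (hP : Function.Injective P) : deltaM S P ∈ RhatE := by
  obtain ⟨m, hm⟩ := hS
  obtain ⟨g, gs, hg⟩ := Md_real m
  have hF : ∀ x y z w, [x, y, z, w].Nodup →
      fstCoord S x y z w = g x w + g y z - g x z - g y w := by
    intro x y z w h
    rw [fstCoord, hm _ (admissible_of_injective (inj_vec4 h)), hg _ _ _ _ h]
  refine ⟨fun i => (S.mem_L4_iff _ (admissible_of_injective (del_inj hP i))).2 (del_inj hP i), ?_⟩
  intro p q hpq
  rw [deltaM_eq S P hP, rfunE_coe]
  norm_cast
  have n : [P 0, P 1, P 2, P 3, P 4].Nodup := by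
    rw [← List.nodup_ofFn] at hP; simpa [List.ofFn_succ] using hP
  rw [← vec5_eta P, codiffReal_vec]
  generalize P 0 = x1 at *
  generalize P 1 = x2 at *
  generalize P 2 = x3 at *
  generalize P 3 = x4 at *
  generalize P 4 = x5 at *
  have e : codiffVec (fstCoord S) x1 x2 x3 x4 x5 =
      codiffVec (fun x y z w => g x w + g y z - g x z - g y w) x1 x2 x3 x4 x5 := by
    simp only [codiffVec]
    have n' := n
    simp only [List.nodup_cons, List.mem_cons, List.not_mem_nil, not_or] at n'
    rw [hF x2 x3 x4 x5 (by simp; grind), hF x2 x4 x5 x3 (by simp; grind),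
      hF x2 x5 x3 x4 (by simp; grind), hF x1 x3 x4 x5 (by simp; grind),
      hF x1 x4 x5 x3 (by simp; grind), hF x1 x5 x3 x4 (by simp; grind),
      hF x1 x2 x4 x5 (by simp; grind), hF x1 x4 x5 x2 (by simp; grind),
      hF x1 x5 x2 x4 (by simp; grind), hF x1 x2 x3 x5 (by simp; grind),
      hF x1 x3 x5 x2 (by simp; grind), hF x1 x5 x2 x3 (by simp; grind),
      hF x1 x2 x3 x4 (by simp; grind), hF x1 x3 x4 x2 (by simp; grind),
      hF x1 x4 x2 x3 (by simp; grind)]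
  rw [e]
  have g32 := gs x3 x2
  have g42 := gs x4 x2
  have g43 := gs x4 x3
  have g52 := gs x5 x2
  have g53 := gs x5 x3
  have g54 := gs x5 x4
  fin_cases p <;> fin_cases q <;> first | (exact absurd hpq (by decide)) | skip
  all_goals
    simp [rfun, rc, codiffVec, Fin.sum_univ_succ]
    linarith

/-- The semi-metric with `(x|y) = g x y` off the diagonal. -/
lemma exists_semimetric {X : Type*} (g : X → X → ℝ) (gs : ∀ x y, g x y = g y x) :
    ∃ m : SemiMetric X, (∀ x, ip m x x = ⊤) ∧ ∀ x y, x ≠ y → ip m x y = (g x y : EReal) := by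
  classical
  refine ⟨⟨fun x y => if x = y then 0 else EReal.exp ((-g x y : ℝ) : EReal), ?_, ?_, ?_⟩, ?_, ?_⟩
  · intro x y
    by_cases h : x = y
    · subst h; rfl
    · simp only [if_neg h, if_neg (Ne.symm h), gs x y]
  · intro x y
    by_cases h : x = y
    · simp [h]
    · rw [if_neg h, EReal.exp_eq_zero_iff]
      exact iff_of_false (EReal.coe_ne_bot _) h
  · refine ⟨∅, Set.subsingleton_empty, fun x y h => ?_⟩
    simp only [if_neg h, EReal.exp_eq_top_iff, EReal.coe_ne_top, Set.mem_empty_iff_false, or_self]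
  · intro x
    simp [ip]
  · intro x y h
    simp only [ip, if_neg h, EReal.log_exp]
    norm_cast
    ring

lemma cd4_top {p q : EReal} (hp : p = ⊤ ∨ q = ⊤) (hp' : p ≠ ⊥) (hq' : q ≠ ⊥) (r s : ℝ) :
    cd4 p q r s = ⊤ ∧ cd4 r s p q = ⊥ := by
  have e : p + q = ⊤ := by
    rcases hp with h | h
    · subst h; exact EReal.top_add_of_ne_bot hq'
    · subst h; exact EReal.add_top_of_ne_bot hp'
  have c1 : cd4 p q r s = (p + q) - (r + s) := by
    unfold cd4
    rw [if_neg, if_neg, if_neg, if_neg] <;>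
    · rintro ⟨h | h, h'⟩ <;> simp [h] at h'
  have c2 : cd4 r s p q = (r + s) - (p + q) := by
    simp [cd4]
  rw [c1, c2, e, ← EReal.coe_add]
  exact ⟨EReal.top_sub_coe _, EReal.sub_top _⟩

lemma cd4_zero (p q r s : ℝ) (h : p + q = r + s) : cd4 p q r s = 0 := by
  rw [cd4_real, show p + q - r - s = 0 by linarith]; rfl

lemma Md_deg {X : Type*} (m : SemiMetric X) (g : X → X → ℝ) (gs : ∀ x y, g x y = g y x)
    (m1 : ∀ x, ip m x x = ⊤) (m2 : ∀ x y, x ≠ y → ip m x y = (g x y : EReal))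
    (Q : Fin 4 → X) (hQ : Admissible4 Q) :
    ((Q 0 = Q 1 ∨ Q 2 = Q 3) → Md m Q = ![0, ⊤, ⊥]) ∧
    ((Q 0 = Q 2 ∨ Q 1 = Q 3) → Md m Q = ![⊥, 0, ⊤]) ∧
    ((Q 0 = Q 3 ∨ Q 1 = Q 2) → Md m Q = ![⊤, ⊥, 0]) := by
  have nb : ∀ x y, ip m x y ≠ ⊥ := by
    intro x y
    by_cases h : x = y
    · subst h; rw [m1]; simp
    · rw [m2 _ _ h]; exact EReal.coe_ne_bot _
  have t : ∀ x y, x = y → ip m x y = ⊤ := by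
    intro x y h; subst h; exact m1 x
  have q012 := hQ 0 1 2 (by decide) (by decide) (by decide)
  have q013 := hQ 0 1 3 (by decide) (by decide) (by decide)
  have q023 := hQ 0 2 3 (by decide) (by decide) (by decide)
  have q123 := hQ 1 2 3 (by decide) (by decide) (by decide)
  refine ⟨fun h => ?_, fun h => ?_, fun h => ?_⟩
  · have n03 : Q 0 ≠ Q 3 := by grind
    have n12 : Q 1 ≠ Q 2 := by grind
    have n02 : Q 0 ≠ Q 2 := by grind
    have n13 : Q 1 ≠ Q 3 := by grind
    have T := fun r s => cd4_top (h.imp (t _ _) (t _ _)) (nb (Q 0) (Q 1)) (nb (Q 2) (Q 3)) r s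
    simp only [Md, m2 _ _ n03, m2 _ _ n12, m2 _ _ n02, m2 _ _ n13, (T _ _).1, (T _ _).2]
    rw [cd4_zero]
    rcases h with h | h <;> rw [h]
    · ring
  · have n03 : Q 0 ≠ Q 3 := by grind
    have n12 : Q 1 ≠ Q 2 := by grind
    have n01 : Q 0 ≠ Q 1 := by grind
    have n23 : Q 2 ≠ Q 3 := by grind
    have T := fun r s => cd4_top (h.symm.imp (t _ _) (t _ _)) (nb (Q 1) (Q 3)) (nb (Q 0) (Q 2)) r s
    have T' := fun r s => cd4_top (h.imp (t _ _) (t _ _)) (nb (Q 0) (Q 2)) (nb (Q 1) (Q 3)) r s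
    simp only [Md, m2 _ _ n03, m2 _ _ n12, m2 _ _ n01, m2 _ _ n23, (T _ _).1, (T' _ _).2]
    rw [cd4_zero]
    rcases h with h | h
    · rw [h, gs (Q 2) (Q 1)]; ring
    · rw [← h, gs (Q 2) (Q 1)]
  · have n02 : Q 0 ≠ Q 2 := by grind
    have n13 : Q 1 ≠ Q 3 := by grind
    have n01 : Q 0 ≠ Q 1 := by grind
    have n23 : Q 2 ≠ Q 3 := by grind
    have T := fun r s => cd4_top (h.imp (t _ _) (t _ _)) (nb (Q 0) (Q 3)) (nb (Q 1) (Q 2)) r s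
    simp only [Md, m2 _ _ n02, m2 _ _ n13, m2 _ _ n01, m2 _ _ n23, (T _ _).1, (T _ _).2]
    rw [cd4_zero]
    rcases h with h | h
    · rw [h, gs (Q 1) (Q 3), gs (Q 2) (Q 3)]
    · rw [h]; ring

lemma M_deg {X : Type*} (S : SubMoebius X) (Q : Fin 4 → X) (hQ : Admissible4 Q)
    (π : Equiv.Perm (Fin 4)) (h : Q (π 0) = Q (π 1)) :
    S.M Q = signedAct3 (Equiv.Perm.sign π) (phi π) ![0, ⊤, ⊥] := by
  have hA : Admissible4 (fun k => Q (π k)) := fun i j k h1 h2 h3 =>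
    hQ _ _ _ (π.injective.ne h1) (π.injective.ne h2) (π.injective.ne h3)
  have e := S.equivariant _ hA π
  have e1 : (fun k => Q (π (π⁻¹ k))) = Q := by funext k; simp
  have e2 : (fun k => Q (π k)) = ![Q (π 0), Q (π 0), Q (π 2), Q (π 3)] := by
    funext k; fin_cases k
    · rfl
    · exact h.symm
    · rfl
    · rfl
  rw [e1] at e
  rw [e]
  congr 1
  rw [e2] at hA ⊢
  exact S.diag _ _ _ hA

lemma signed_swap (i j : Fin 4) (h : i ≠ j) (p : Fin 3 → EReal) :
    signedAct3 (Equiv.Perm.sign (Equiv.swap i j)) (phi (Equiv.swap i j)) p =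
      fun k => - p ((phi (Equiv.swap i j))⁻¹ k) := by
  funext k
  rw [signedAct3, Equiv.Perm.sign_swap h, if_neg (by decide)]

lemma M_deg' {X : Type*} (S : SubMoebius X) (Q : Fin 4 → X) (hQ : Admissible4 Q) :
    ((Q 0 = Q 1 ∨ Q 2 = Q 3) → S.M Q = ![0, ⊤, ⊥]) ∧
    ((Q 0 = Q 2 ∨ Q 1 = Q 3) → S.M Q = ![⊥, 0, ⊤]) ∧
    ((Q 0 = Q 3 ∨ Q 1 = Q 2) → S.M Q = ![⊤, ⊥, 0]) := by
  refine ⟨fun h => ?_, fun h => ?_, fun h => ?_⟩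
  · rcases h with h | h
    · rw [M_deg S Q hQ 1 h]
      have p : (phi 1)⁻¹ = 1 := by decide
      funext k; simp [signedAct3, p]
    · rw [M_deg S Q hQ dbl h]
      have p : (phi dbl)⁻¹ = 1 := by decide
      have sg : Equiv.Perm.sign dbl = 1 := by decide
      funext k; simp [signedAct3, p, sg]
  · rcases h with h | h
    · rw [M_deg S Q hQ (Equiv.swap 1 2) h, signed_swap _ _ (by decide)]
      have p : (phi (Equiv.swap 1 2))⁻¹ = Equiv.swap 0 1 := by decide
      rw [p]
      funext k; fin_cases k <;> simp [Equiv.swap_apply_def]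
    · rw [M_deg S Q hQ (Equiv.swap 0 3) h.symm, signed_swap _ _ (by decide)]
      have p : (phi (Equiv.swap 0 3))⁻¹ = Equiv.swap 0 1 := by decide
      rw [p]
      funext k; fin_cases k <;> simp [Equiv.swap_apply_def]
  · rcases h with h | h
    · rw [M_deg S Q hQ (Equiv.swap 1 3) h, signed_swap _ _ (by decide)]
      have p : (phi (Equiv.swap 1 3))⁻¹ = Equiv.swap 0 2 := by decide
      rw [p]
      funext k; fin_cases k <;> simp [Equiv.swap_apply_def]
    · rw [M_deg S Q hQ (Equiv.swap 0 2) h.symm, signed_swap _ _ (by decide)]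
      have p : (phi (Equiv.swap 0 2))⁻¹ = Equiv.swap 0 2 := by decide
      rw [p]
      funext k; fin_cases k <;> simp [Equiv.swap_apply_def]

lemma moebius_of_root {X : Type*} (S : SubMoebius X) (p q : Fin 5) (hpq : p < q)
    (H : ∀ P : Fin 5 → X, Function.Injective P → deltaM S P ∈ RrootE p q) : IsMoebius S := by
  have H' : ∀ P : Fin 5 → X, Function.Injective P →
      rfun p q (codiffReal (fstCoord S) P) = 0 := by
    intro P hP
    have := (H P hP).2
    rw [deltaM_eq S P hP, rfunE_coe] at this
    exact_mod_cast this
  obtain ⟨g, gs, hg⟩ := exists_potential (fstCoord S) (F_swap S) (F_dbl S)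
    (fun x y z w h => (M_eq S x y z w h).2) (cocycle_of_root S p q hpq H')
  obtain ⟨m, m1, m2⟩ := exists_semimetric g gs
  refine ⟨m, fun Q hQ => ?_⟩
  have A := M_deg' S Q hQ
  have B := Md_deg m g gs m1 m2 Q hQ
  by_cases c1 : Q 0 = Q 1 ∨ Q 2 = Q 3
  · rw [A.1 c1, B.1 c1]
  by_cases c2 : Q 0 = Q 2 ∨ Q 1 = Q 3
  · rw [A.2.1 c2, B.2.1 c2]
  by_cases c3 : Q 0 = Q 3 ∨ Q 1 = Q 2
  · rw [A.2.2 c3, B.2.2 c3]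
  push Not at c1 c2 c3
  have n : [Q 0, Q 1, Q 2, Q 3].Nodup := by simp; grind
  have n1 : [Q 0, Q 2, Q 3, Q 1].Nodup := by simp; grind
  have n2 : [Q 0, Q 3, Q 1, Q 2].Nodup := by simp; grind
  have e := (M_eq S _ _ _ _ n).1
  rw [vec4_eta, hg _ _ _ _ n, hg _ _ _ _ n1, hg _ _ _ _ n2] at e
  rw [e]
  simp only [Md, m2 _ _ c1.1, m2 _ _ c1.2, m2 _ _ c2.1, m2 _ _ c2.2, m2 _ _ c3.1, m2 _ _ c3.2,
    cd4_real]
  funext j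
  have g21 := gs (Q 2) (Q 1)
  have g31 := gs (Q 3) (Q 1)
  have g32 := gs (Q 3) (Q 2)
  fin_cases j <;> simp only [Fin.zero_eta, Fin.mk_one, Fin.reduceFinMk, Matrix.cons_val] <;>
    congr 1 <;> linarith

end Helpers

/-- Proposition 5.2: for a sub-Möbius structure `M` on `X` the following are equivalent:
(i) `M` is a Möbius structure; (ii) `δM(reg 𝒫₅) ⊆ R_λ` for some edge `λ ∈ Λ`;
(iii) `δM(reg 𝒫₅) ⊆ R̂`. -/
theorem moebius_iff_codifferential_roots {X : Type*} (S : SubMoebius X) :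
    (IsMoebius S ↔ ∃ p q : Fin 5, p < q ∧
      ∀ P : Fin 5 → X, Function.Injective P → deltaM S P ∈ RrootE p q) ∧
    (IsMoebius S ↔
      ∀ P : Fin 5 → X, Function.Injective P → deltaM S P ∈ RhatE) := by
  have h13 : IsMoebius S → ∀ P : Fin 5 → X, Function.Injective P → deltaM S P ∈ RhatE :=
    fun h P hP => rhat_of_moebius S h P hP
  have h32 : (∀ P : Fin 5 → X, Function.Injective P → deltaM S P ∈ RhatE) →
      ∃ p q : Fin 5, p < q ∧
        ∀ P : Fin 5 → X, Function.Injective P → deltaM S P ∈ RrootE p q :=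
    fun h => ⟨0, 1, by decide, fun P hP => ⟨(h P hP).1, (h P hP).2 0 1 (by decide)⟩⟩
  have h21 : (∃ p q : Fin 5, p < q ∧
      ∀ P : Fin 5 → X, Function.Injective P → deltaM S P ∈ RrootE p q) → IsMoebius S := by
    rintro ⟨p, q, hpq, H⟩
    exact moebius_of_root S p q hpq H
  exact ⟨⟨fun h => h32 (h13 h), h21⟩, ⟨h13, fun h => h21 (h32 h)⟩⟩
end

section
/- The symmetry set R̂ = ⋂_{λ∈Λ} {v ∈ L_5 : r_λ(v) = 0} is an η_5-invariant subspace of L_5 of dimension 5, the restriction of η_5 to R̂ is an irreducible representation of S_5, and Tr(η_5(τ)|R̂) = 1 for every transposition τ ∈ S_5 (so the character of η_5|R̂ is the prime character χ^{32} of S_5). -/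
open Equiv

/-- `η₄ : S₄ → Aut(V⁴)`, `V⁴ = ℝ³`: the signed cross-ratio representation,
`η₄(π)(e_j) = sign(π) e_{φ(π) j}`. -/
noncomputable def eta4fun (π : Equiv.Perm (Fin 4)) (v : Fin 3 → ℝ) : Fin 3 → ℝ :=
  fun j => ((Equiv.Perm.sign π : ℤ) : ℝ) * v ((phi π)⁻¹ j)

/-- The canonical representation `η₅ : S₅ → Aut(V⁵)` on the space `V⁵` of `5 × 3`
real matrices: `η₅(π)(e_i ⊗ u) = e_{π(i)} ⊗ η₄(π_i)(u)`. -/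
noncomputable def eta5fun (π : Equiv.Perm (Fin 5)) (v : Fin 5 → Fin 3 → ℝ) :
    Fin 5 → Fin 3 → ℝ :=
  fun i => eta4fun (inducedPerm π (π⁻¹ i)) (v (π⁻¹ i))

/-- `η₅(π)` as a linear endomorphism of `V⁵`. -/
noncomputable def eta5lin (π : Equiv.Perm (Fin 5)) :
    (Fin 5 → Fin 3 → ℝ) →ₗ[ℝ] (Fin 5 → Fin 3 → ℝ) where
  toFun := eta5fun π
  map_add' := by
    intro v w; funext i j; simp [eta5fun, eta4fun, mul_add]
  map_smul' := by
    intro c v; funext i j; simp [eta5fun, eta4fun, smul_eq_mul]; ring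

/-- The subspace `L₅ ⊂ V⁵` of `5 × 3` matrices whose rows sum to zero. -/
def L5sub : Submodule ℝ (Fin 5 → Fin 3 → ℝ) where
  carrier := {v | ∀ i, v i 0 + v i 1 + v i 2 = 0}
  zero_mem' := by intro i; simp
  add_mem' := by
    intro a b ha hb i
    have h1 := ha i; have h2 := hb i
    simp only [Pi.add_apply]; linarith
  smul_mem' := by
    intro c a ha i
    simp only [Pi.smul_apply, smul_eq_mul]
    linear_combination c * ha i

/-- The characteristic functional `r_λ` as a linear functional on `V⁵`. -/
def rlin (p q : Fin 5) : (Fin 5 → Fin 3 → ℝ) →ₗ[ℝ] ℝ where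
  toFun := fun v => ∑ i, ∑ j, rc p q i j * v i j
  map_add' := by
    intro v w
    rw [← Finset.sum_add_distrib]
    refine Finset.sum_congr rfl fun i _ => ?_
    rw [← Finset.sum_add_distrib]
    exact Finset.sum_congr rfl fun j _ => by simp [mul_add]
  map_smul' := by
    intro c v
    simp only [RingHom.id_apply, Pi.smul_apply, smul_eq_mul, Finset.mul_sum]
    exact Finset.sum_congr rfl fun i _ => Finset.sum_congr rfl fun j _ => by ring

/-- The symmetry set `R̂ = ⋂_{λ ∈ Λ} {v ∈ L₅ : r_λ(v) = 0}`, a subspace of `L₅`. -/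
def Rhat : Submodule ℝ (Fin 5 → Fin 3 → ℝ) :=
  L5sub ⊓ ⨅ (p : Fin 5), ⨅ (q : Fin 5), ⨅ (_ : p < q), LinearMap.ker (rlin p q)

/-! ### `η₅` is a homomorphism -/

lemma phi_mul : ∀ (π σ : Perm (Fin 4)) (j : Fin 3),
    phiFun (π * σ) j = phiFun π (phiFun σ j) := by
  decide +kernel

lemma inducedPerm_spec {k : ℕ} (π : Perm (Fin (k + 1))) (i : Fin (k + 1)) (x : Fin k) :
    (π i).succAbove (inducedPerm π i x) = π (i.succAbove x) := by
  have h : finSuccAboveEquiv (π i) (inducedPerm π i x)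
      = restrictPerm π i (finSuccAboveEquiv i x) := by
    simp [inducedPerm]
  exact congrArg Subtype.val h

lemma inducedPerm_mul {k : ℕ} (π σ : Perm (Fin (k + 1))) (i : Fin (k + 1)) :
    inducedPerm (π * σ) i = inducedPerm π (σ i) * inducedPerm σ i := by
  ext1 x
  apply Fin.succAbove_right_injective (p := π (σ i))
  have h := inducedPerm_spec (π * σ) i x
  simp only [Perm.mul_apply] at h ⊢
  rw [h, inducedPerm_spec, inducedPerm_spec]

lemma phi_mul' (π σ : Perm (Fin 4)) : phi (π * σ) = phi π * phi σ :=
  Equiv.ext fun j => phi_mul π σ j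

lemma eta5_mul (π σ : Perm (Fin 5)) (v : Fin 5 → Fin 3 → ℝ) :
    eta5lin (π * σ) v = eta5lin π (eta5lin σ v) := by
  funext i j
  obtain ⟨k, rfl⟩ : ∃ k, i = π (σ k) := ⟨σ⁻¹ (π⁻¹ i), by simp⟩
  have hπ : ∀ x, π⁻¹ (π x) = x := fun x => by simp
  have hσ : ∀ x, σ⁻¹ (σ x) = x := fun x => by simp
  simp only [eta5lin, LinearMap.coe_mk, AddHom.coe_mk, eta5fun, eta4fun, mul_inv_rev,
    Perm.mul_apply, hπ, hσ, inducedPerm_mul, phi_mul', map_mul, Units.val_mul,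
    Int.cast_mul]
  ring

lemma eta5_one (v : Fin 5 → Fin 3 → ℝ) : eta5lin 1 v = v := by
  have h1 : ∀ i : Fin 5, inducedPerm (1 : Perm (Fin 5)) i = 1 := by decide +kernel
  have h2 : phi 1 = 1 := by decide +kernel
  funext i j
  simp [eta5lin, eta5fun, eta4fun, h1, h2]

/-! ### Coordinates on `R̂` -/

/-- Parametrisation of `R̂` by `(c₃, b₄, c₄, b₅, c₅)`. -/
def G (p q r s t : ℝ) : Fin 5 → Fin 3 → ℝ :=
  ![![r - t, -p - s, p - r + s + t],
    ![-q + s, -p + q + r - s, p - r],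
    ![-q - r + s + t, -p + q + r - s - t, p],
    ![-q - r, q, r],
    ![-s - t, s, t]]

lemma mem_Rhat_iff (v : Fin 5 → Fin 3 → ℝ) :
    v ∈ Rhat ↔ (∀ i, v i 0 + v i 1 + v i 2 = 0) ∧
      ∀ p q : Fin 5, p < q → ∑ i, ∑ j, rc p q i j * v i j = 0 := by
  simp only [Rhat, Submodule.mem_inf, Submodule.mem_iInf, LinearMap.mem_ker]
  rfl

lemma G_mem (p q r s t : ℝ) : G p q r s t ∈ Rhat := by
  rw [mem_Rhat_iff]
  constructor
  · intro i
    fin_cases i <;> simp [G] <;> ring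
  · intro a b hab
    fin_cases a <;> fin_cases b <;>
      first
      | (exfalso; revert hab; decide)
      | (simp [G, rc, Fin.sum_univ_succ]; try ring)

lemma eq_G {v : Fin 5 → Fin 3 → ℝ} (hv : v ∈ Rhat) :
    v = G (v 2 2) (v 3 1) (v 3 2) (v 4 1) (v 4 2) := by
  rw [mem_Rhat_iff] at hv
  obtain ⟨h, hr⟩ := hv
  have l0 := h 0
  have l1 := h 1
  have l2 := h 2
  have l3 := h 3
  have l4 := h 4
  have r01 := hr 0 1 (by decide)
  have r02 := hr 0 2 (by decide)
  have r03 := hr 0 3 (by decide)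
  have r04 := hr 0 4 (by decide)
  have r12 := hr 1 2 (by decide)
  have r13 := hr 1 3 (by decide)
  have r14 := hr 1 4 (by decide)
  have r23 := hr 2 3 (by decide)
  have r24 := hr 2 4 (by decide)
  have r34 := hr 3 4 (by decide)
  clear h hr
  simp [rc, Fin.sum_univ_five, Fin.sum_univ_three] at r01 r02 r03 r04 r12 r13 r14 r23 r24 r34
  funext i j
  fin_cases i <;> fin_cases j <;> simp [G] <;> linarith

/-! ### Action of the adjacent transpositions -/

lemma eta_entry (π : Perm (Fin 5)) (v : Fin 5 → Fin 3 → ℝ) (i : Fin 5) (j : Fin 3)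
    (s : ℤ) (i' : Fin 5) (j' : Fin 3)
    (h : (Perm.sign (inducedPerm π (π⁻¹ i)) : ℤ) = s ∧ π⁻¹ i = i' ∧
      phiFun (inducedPerm π (π⁻¹ i))⁻¹ j = j') :
    eta5lin π v i j = s * v i' j' := by
  obtain ⟨rfl, rfl, rfl⟩ := h
  rfl

lemma eta_swap0 (p q r s t : ℝ) : eta5lin (swap 0 1) (G p q r s t) =
    G (p - q - r + s + t) (-r) (-q) (-t) (-s) := by
  funext i j
  fin_cases i <;> fin_cases j
  · refine (eta_entry _ _ 0 0 (1) 1 0 (by decide +kernel)).trans ?_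
    simp [G]; try ring
  · refine (eta_entry _ _ 0 1 (1) 1 1 (by decide +kernel)).trans ?_
    simp [G]; try ring
  · refine (eta_entry _ _ 0 2 (1) 1 2 (by decide +kernel)).trans ?_
    simp [G]; try ring
  · refine (eta_entry _ _ 1 0 (1) 0 0 (by decide +kernel)).trans ?_
    simp [G]; try ring
  · refine (eta_entry _ _ 1 1 (1) 0 1 (by decide +kernel)).trans ?_
    simp [G]; try ring
  · refine (eta_entry _ _ 1 2 (1) 0 2 (by decide +kernel)).trans ?_
    simp [G]; try ring
  · refine (eta_entry _ _ 2 0 (-1) 2 0 (by decide +kernel)).trans ?_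
    simp [G]; try ring
  · refine (eta_entry _ _ 2 1 (-1) 2 2 (by decide +kernel)).trans ?_
    simp [G]; try ring
  · refine (eta_entry _ _ 2 2 (-1) 2 1 (by decide +kernel)).trans ?_
    simp [G]; try ring
  · refine (eta_entry _ _ 3 0 (-1) 3 0 (by decide +kernel)).trans ?_
    simp [G]; try ring
  · refine (eta_entry _ _ 3 1 (-1) 3 2 (by decide +kernel)).trans ?_
    simp [G]; try ring
  · refine (eta_entry _ _ 3 2 (-1) 3 1 (by decide +kernel)).trans ?_
    simp [G]; try ring
  · refine (eta_entry _ _ 4 0 (-1) 4 0 (by decide +kernel)).trans ?_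
    simp [G]; try ring
  · refine (eta_entry _ _ 4 1 (-1) 4 2 (by decide +kernel)).trans ?_
    simp [G]; try ring
  · refine (eta_entry _ _ 4 2 (-1) 4 1 (by decide +kernel)).trans ?_
    simp [G]; try ring

lemma eta_swap1 (p q r s t : ℝ) : eta5lin (swap 1 2) (G p q r s t) =
    G (p - r) (q + r) (-r) (s + t) (-t) := by
  funext i j
  fin_cases i <;> fin_cases j
  · refine (eta_entry _ _ 0 0 (-1) 0 0 (by decide +kernel)).trans ?_
    simp [G]; try ring
  · refine (eta_entry _ _ 0 1 (-1) 0 2 (by decide +kernel)).trans ?_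
    simp [G]; try ring
  · refine (eta_entry _ _ 0 2 (-1) 0 1 (by decide +kernel)).trans ?_
    simp [G]; try ring
  · refine (eta_entry _ _ 1 0 (1) 2 0 (by decide +kernel)).trans ?_
    simp [G]; try ring
  · refine (eta_entry _ _ 1 1 (1) 2 1 (by decide +kernel)).trans ?_
    simp [G]; try ring
  · refine (eta_entry _ _ 1 2 (1) 2 2 (by decide +kernel)).trans ?_
    simp [G]; try ring
  · refine (eta_entry _ _ 2 0 (1) 1 0 (by decide +kernel)).trans ?_
    simp [G]; try ring
  · refine (eta_entry _ _ 2 1 (1) 1 1 (by decide +kernel)).trans ?_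
    simp [G]; try ring
  · refine (eta_entry _ _ 2 2 (1) 1 2 (by decide +kernel)).trans ?_
    simp [G]; try ring
  · refine (eta_entry _ _ 3 0 (-1) 3 1 (by decide +kernel)).trans ?_
    simp [G]; try ring
  · refine (eta_entry _ _ 3 1 (-1) 3 0 (by decide +kernel)).trans ?_
    simp [G]; try ring
  · refine (eta_entry _ _ 3 2 (-1) 3 2 (by decide +kernel)).trans ?_
    simp [G]; try ring
  · refine (eta_entry _ _ 4 0 (-1) 4 1 (by decide +kernel)).trans ?_
    simp [G]; try ring
  · refine (eta_entry _ _ 4 1 (-1) 4 0 (by decide +kernel)).trans ?_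
    simp [G]; try ring
  · refine (eta_entry _ _ 4 2 (-1) 4 2 (by decide +kernel)).trans ?_
    simp [G]; try ring

lemma eta_swap2 (p q r s t : ℝ) : eta5lin (swap 2 3) (G p q r s t) =
    G (r) (-p + q + r - s - t) (p) (-t) (-s) := by
  funext i j
  fin_cases i <;> fin_cases j
  · refine (eta_entry _ _ 0 0 (-1) 0 1 (by decide +kernel)).trans ?_
    simp [G]; try ring
  · refine (eta_entry _ _ 0 1 (-1) 0 0 (by decide +kernel)).trans ?_
    simp [G]; try ring
  · refine (eta_entry _ _ 0 2 (-1) 0 2 (by decide +kernel)).trans ?_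
    simp [G]; try ring
  · refine (eta_entry _ _ 1 0 (-1) 1 1 (by decide +kernel)).trans ?_
    simp [G]; try ring
  · refine (eta_entry _ _ 1 1 (-1) 1 0 (by decide +kernel)).trans ?_
    simp [G]; try ring
  · refine (eta_entry _ _ 1 2 (-1) 1 2 (by decide +kernel)).trans ?_
    simp [G]; try ring
  · refine (eta_entry _ _ 2 0 (1) 3 0 (by decide +kernel)).trans ?_
    simp [G]; try ring
  · refine (eta_entry _ _ 2 1 (1) 3 1 (by decide +kernel)).trans ?_
    simp [G]; try ring
  · refine (eta_entry _ _ 2 2 (1) 3 2 (by decide +kernel)).trans ?_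
    simp [G]; try ring
  · refine (eta_entry _ _ 3 0 (1) 2 0 (by decide +kernel)).trans ?_
    simp [G]; try ring
  · refine (eta_entry _ _ 3 1 (1) 2 1 (by decide +kernel)).trans ?_
    simp [G]; try ring
  · refine (eta_entry _ _ 3 2 (1) 2 2 (by decide +kernel)).trans ?_
    simp [G]; try ring
  · refine (eta_entry _ _ 4 0 (-1) 4 0 (by decide +kernel)).trans ?_
    simp [G]; try ring
  · refine (eta_entry _ _ 4 1 (-1) 4 2 (by decide +kernel)).trans ?_
    simp [G]; try ring
  · refine (eta_entry _ _ 4 2 (-1) 4 1 (by decide +kernel)).trans ?_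
    simp [G]; try ring

lemma eta_swap3 (p q r s t : ℝ) : eta5lin (swap 3 4) (G p q r s t) =
    G (p - q - r + s + t) (s) (t) (q) (r) := by
  funext i j
  fin_cases i <;> fin_cases j
  · refine (eta_entry _ _ 0 0 (-1) 0 0 (by decide +kernel)).trans ?_
    simp [G]; try ring
  · refine (eta_entry _ _ 0 1 (-1) 0 2 (by decide +kernel)).trans ?_
    simp [G]; try ring
  · refine (eta_entry _ _ 0 2 (-1) 0 1 (by decide +kernel)).trans ?_
    simp [G]; try ring
  · refine (eta_entry _ _ 1 0 (-1) 1 0 (by decide +kernel)).trans ?_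
    simp [G]; try ring
  · refine (eta_entry _ _ 1 1 (-1) 1 2 (by decide +kernel)).trans ?_
    simp [G]; try ring
  · refine (eta_entry _ _ 1 2 (-1) 1 1 (by decide +kernel)).trans ?_
    simp [G]; try ring
  · refine (eta_entry _ _ 2 0 (-1) 2 0 (by decide +kernel)).trans ?_
    simp [G]; try ring
  · refine (eta_entry _ _ 2 1 (-1) 2 2 (by decide +kernel)).trans ?_
    simp [G]; try ring
  · refine (eta_entry _ _ 2 2 (-1) 2 1 (by decide +kernel)).trans ?_
    simp [G]; try ring
  · refine (eta_entry _ _ 3 0 (1) 4 0 (by decide +kernel)).trans ?_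
    simp [G]; try ring
  · refine (eta_entry _ _ 3 1 (1) 4 1 (by decide +kernel)).trans ?_
    simp [G]; try ring
  · refine (eta_entry _ _ 3 2 (1) 4 2 (by decide +kernel)).trans ?_
    simp [G]; try ring
  · refine (eta_entry _ _ 4 0 (1) 3 0 (by decide +kernel)).trans ?_
    simp [G]; try ring
  · refine (eta_entry _ _ 4 1 (1) 3 1 (by decide +kernel)).trans ?_
    simp [G]; try ring
  · refine (eta_entry _ _ 4 2 (1) 3 2 (by decide +kernel)).trans ?_
    simp [G]; try ring

lemma G_add (p q r s t p' q' r' s' t' : ℝ) :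
    G p q r s t + G p' q' r' s' t' = G (p + p') (q + q') (r + r') (s + s') (t + t') := by
  funext i j
  fin_cases i <;> fin_cases j <;> simp [G] <;> ring

lemma G_smul (c p q r s t : ℝ) :
    c • G p q r s t = G (c * p) (c * q) (c * r) (c * s) (c * t) := by
  funext i j
  fin_cases i <;> fin_cases j <;> simp [G] <;> ring

/-! ### Invariance -/

/-- The permutations preserving `R̂`, as a subgroup-like closure argument on adjacent swaps. -/
lemma eta_inv (π : Perm (Fin 5)) : ∀ v ∈ Rhat, eta5lin π v ∈ Rhat := by
  have key : π ∈ Submonoid.closure (Set.range fun i : Fin 4 => swap i.castSucc i.succ) := by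
    rw [Perm.mclosure_swap_castSucc_succ]
    trivial
  induction key using Submonoid.closure_induction with
  | mem x hx =>
    obtain ⟨i, rfl⟩ := hx
    intro v hv
    rw [eq_G hv]
    fin_cases i
    · exact (eta_swap0 _ _ _ _ _).symm ▸ G_mem _ _ _ _ _
    · exact (eta_swap1 _ _ _ _ _).symm ▸ G_mem _ _ _ _ _
    · exact (eta_swap2 _ _ _ _ _).symm ▸ G_mem _ _ _ _ _
    · exact (eta_swap3 _ _ _ _ _).symm ▸ G_mem _ _ _ _ _
  | one => intro v hv; rwa [eta5_one]
  | mul x y _ _ hx hy => intro v hv; rw [eta5_mul]; exact hx _ (hy _ hv)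

/-! ### Dimension -/

/-- The coordinate isomorphism. -/
def coordEquiv : Rhat ≃ₗ[ℝ] (Fin 5 → ℝ) where
  toFun v := ![v.1 2 2, v.1 3 1, v.1 3 2, v.1 4 1, v.1 4 2]
  map_add' v w := by ext i; fin_cases i <;> rfl
  map_smul' c v := by ext i; fin_cases i <;> rfl
  invFun x := ⟨G (x 0) (x 1) (x 2) (x 3) (x 4), G_mem _ _ _ _ _⟩
  left_inv v := Subtype.ext (eq_G v.2).symm
  right_inv x := by ext i; fin_cases i <;> rfl

lemma finrank_Rhat : Module.finrank ℝ Rhat = 5 := by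
  rw [coordEquiv.finrank_eq]; simp

/-! ### Trace -/

lemma trace_swap0 (h : ∀ v ∈ Rhat, eta5lin (swap 0 1) v ∈ Rhat) :
    LinearMap.trace ℝ Rhat ((eta5lin (swap 0 1)).restrict h) = 1 := by
  have hc : coordEquiv.conj ((eta5lin (swap 0 1)).restrict h) = Matrix.toLin'
      !![1, -1, -1, 1, 1; 0, 0, -1, 0, 0; 0, -1, 0, 0, 0; 0, 0, 0, 0, -1; 0, 0, 0, -1, 0] := by
    apply LinearMap.ext
    intro x
    have e : ((eta5lin (swap 0 1)).restrict h) (coordEquiv.symm x) =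
        ⟨_, G_mem (x 0 - x 1 - x 2 + x 3 + x 4) (-x 2) (-x 1) (-x 4) (-x 3)⟩ :=
      Subtype.ext (eta_swap0 _ _ _ _ _)
    rw [LinearEquiv.conj_apply_apply, e]
    ext i
    fin_cases i <;> simp [coordEquiv, G, Matrix.mulVec, dotProduct, Fin.sum_univ_five] <;> ring
  rw [← LinearMap.trace_conj' _ coordEquiv, hc, Matrix.trace_toLin'_eq]
  simp [Matrix.trace, Fin.sum_univ_five]

lemma trace_transp (π : Perm (Fin 5)) (hπ : π.cycleType = {2})
    (h : ∀ v ∈ Rhat, eta5lin π v ∈ Rhat) :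
    LinearMap.trace ℝ Rhat ((eta5lin π).restrict h) = 1 := by
  have hs : (swap (0 : Fin 5) 1).cycleType = {2} :=
    Perm.isSwap_iff_cycleType.1 ⟨0, 1, by decide, rfl⟩
  obtain ⟨c, hc⟩ := isConj_iff.1 (Perm.isConj_iff_cycleType_eq.2 (hs.trans hπ.symm))
  have e : (eta5lin π).restrict h =
      (eta5lin c).restrict (eta_inv c) *
        ((eta5lin (swap 0 1)).restrict (eta_inv (swap 0 1)) *
          (eta5lin c⁻¹).restrict (eta_inv c⁻¹)) := by
    apply LinearMap.ext
    intro v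
    apply Subtype.ext
    change eta5lin π v.1 = eta5lin c (eta5lin (swap 0 1) (eta5lin c⁻¹ v.1))
    rw [← eta5_mul, ← eta5_mul, ← hc, mul_assoc]
  have e1 : (eta5lin c⁻¹).restrict (eta_inv c⁻¹) * (eta5lin c).restrict (eta_inv c) = 1 := by
    apply LinearMap.ext
    intro v
    apply Subtype.ext
    change eta5lin c⁻¹ (eta5lin c v.1) = v.1
    rw [← eta5_mul, inv_mul_cancel, eta5_one]
  rw [e, LinearMap.trace_mul_comm, mul_assoc, e1, mul_one, trace_swap0]

/-! ### Irreducibility -/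

lemma G_zero : G 0 0 0 0 0 = 0 := by
  funext i j
  fin_cases i <;> fin_cases j <;> simp [G]

lemma irred (W : Submodule ℝ (Fin 5 → Fin 3 → ℝ)) (hW : W ≤ Rhat)
    (hinv : ∀ π : Perm (Fin 5), ∀ v ∈ W, eta5lin π v ∈ W) : W = ⊥ ∨ W = Rhat := by
  have hadd : ∀ {p q r s t p' q' r' s' t' : ℝ}, G p q r s t ∈ W → G p' q' r' s' t' ∈ W →
      G (p + p') (q + q') (r + r') (s + s') (t + t') ∈ W :=
    fun h h' => G_add _ _ _ _ _ _ _ _ _ _ ▸ W.add_mem h h'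
  have hsmul : ∀ (c : ℝ) {p q r s t : ℝ}, G p q r s t ∈ W →
      G (c * p) (c * q) (c * r) (c * s) (c * t) ∈ W :=
    fun c _ _ _ _ _ h => G_smul c _ _ _ _ _ ▸ W.smul_mem c h
  have s0 : ∀ {p q r s t : ℝ}, G p q r s t ∈ W → _ :=
    fun h => eta_swap0 _ _ _ _ _ ▸ hinv (swap 0 1) _ h
  have s1 : ∀ {p q r s t : ℝ}, G p q r s t ∈ W → _ :=
    fun h => eta_swap1 _ _ _ _ _ ▸ hinv (swap 1 2) _ h
  have s2 : ∀ {p q r s t : ℝ}, G p q r s t ∈ W → _ :=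
    fun h => eta_swap2 _ _ _ _ _ ▸ hinv (swap 2 3) _ h
  have s3 : ∀ {p q r s t : ℝ}, G p q r s t ∈ W → _ :=
    fun h => eta_swap3 _ _ _ _ _ ▸ hinv (swap 3 4) _ h
  -- the symmetriser of `S₃ × S₂` maps everything to a multiple of `G 1 0 0 0 0`
  have hP : ∀ {p q r s t : ℝ}, G p q r s t ∈ W →
      G (12 * p - 4 * q - 8 * r + 8 * s + 4 * t) 0 0 0 0 ∈ W := by
    intro p q r s t h
    have h1 := hadd h (s3 h)
    have h2 := hadd h1 (s1 h1)
    have h3 := hadd (hadd h2 (s0 h2)) (s1 (s0 (s1 h2)))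
    convert h3 using 1
    congr 1 <;> ring
  by_cases hℓ : ∀ p q r s t : ℝ, G p q r s t ∈ W → 12 * p - 4 * q - 8 * r + 8 * s + 4 * t = 0
  · left
    rw [eq_bot_iff]
    intro v hv
    have hG := eq_G (hW hv)
    rw [Submodule.mem_bot, hG, ← G_zero]
    rw [hG] at hv
    have a0 := hℓ _ _ _ _ _ hv
    have a1 := hℓ _ _ _ _ _ (s2 hv)
    have a2 := hℓ _ _ _ _ _ (s2 (s3 hv))
    have a3 := hℓ _ _ _ _ _ (s2 (s1 hv))
    have a4 := hℓ _ _ _ _ _ (s2 (s1 (s3 hv)))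
    congr 1 <;> linarith
  · right
    push Not at hℓ
    obtain ⟨p, q, r, s, t, h, hne⟩ := hℓ
    have e1 : G 1 0 0 0 0 ∈ W := by
      have := hsmul (12 * p - 4 * q - 8 * r + 8 * s + 4 * t)⁻¹ (hP h)
      simpa [inv_mul_cancel₀ hne] using this
    refine le_antisymm hW fun v hv => ?_
    rw [eq_G hv]
    generalize v 2 2 = x0
    generalize v 3 1 = x1
    generalize v 3 2 = x2
    generalize v 4 1 = x3
    generalize v 4 2 = x4
    -- `(0,-1,1,0,0)`, `(-1,0,-1,0,0)` and their images under `swap 3 4`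
    have f1 := s2 e1
    have f2 := s1 f1
    have f3 := s3 f1
    have f4 := s3 f2
    have := hadd (hadd (hadd (hadd (hsmul (x0 + (-x1 - x2)) e1) (hsmul (-x1) f1))
      (hsmul (-x1 - x2) f2)) (hsmul (-x3) f3)) (hsmul (-x3 - x4) f4)
    convert this using 1
    congr 1 <;> ring

/-- Proposition 5.3 (part): the symmetry set `R̂` is an `η₅`-invariant 5-dimensional
subspace of `L₅`, the restriction of `η₅` to `R̂` is irreducible, and its trace on every
transposition equals `1`; hence the character of `η₅|R̂` is the prime character `χ^{32}`. -/
theorem Rhat_irreducible_chi32 :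
    (∀ π : Equiv.Perm (Fin 5), ∀ v ∈ Rhat, eta5lin π v ∈ Rhat) ∧
    Module.finrank ℝ Rhat = 5 ∧
    (∀ W : Submodule ℝ (Fin 5 → Fin 3 → ℝ), W ≤ Rhat →
      (∀ π : Equiv.Perm (Fin 5), ∀ v ∈ W, eta5lin π v ∈ W) → W = ⊥ ∨ W = Rhat) ∧
    (∀ π : Equiv.Perm (Fin 5), π.cycleType = {2} →
      ∀ h : ∀ v ∈ Rhat, eta5lin π v ∈ Rhat,
        LinearMap.trace ℝ Rhat ((eta5lin π).restrict h) = 1) := by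
  exact ⟨eta_inv, finrank_Rhat, irred, trace_transp⟩
end
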